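/- Every φ-term parallel-reduces to its complete development: for every φ-term t, t ⇛ t⁺. -/

import Mathlib

namespace PhiCalc

/-- φ-terms over a set of attribute labels `L`. An object term carries a finite
list of attributes: `(a, none)` is a void attribute, `(b, some t)` is an
attached attribute. -/
inductive Tm (L : Type) : Type where
  | loc : Nat → Tm L
  | dot : Tm L → L → Tm L
  | app : Tm L → L → Tm L → Tm L
  | obj : List (L × Option (Tm L)) → Tm L

namespace Tm

variable {L : Type}

/-- Look up a label among the attributes of an object:
`none` = the label is missing, `some none` = void attribute,
`some (some t)` = attribute attached to `t`. -/
def lookupAttr [DecidableEq L] (a : L) : List (L × Option (Tm L)) → Option (Option (Tm L))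
  | [] => none
  | (b, o) :: rest => if a = b then some o else lookupAttr a rest

/-- Attach term `u` to the (first occurrence of) label `a`. -/
def attachAttr [DecidableEq L] (a : L) (u : Tm L) :
    List (L × Option (Tm L)) → List (L × Option (Tm L))
  | [] => []
  | (b, o) :: rest => if a = b then (b, some u) :: rest else (b, o) :: attachAttr a u rest

mutual
/-- Locator increment `↑ₙ t`. -/
def incAt : Nat → Tm L → Tm L
  | n, loc m => if m < n then loc m else loc (m + 1)
  | n, dot t a => dot (incAt n t) a
  | n, app t a u => app (incAt n t) a (incAt n u)
  | n, obj attrs => obj (incAtList (n + 1) attrs)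

def incAtList : Nat → List (L × Option (Tm L)) → List (L × Option (Tm L))
  | _, [] => []
  | n, (a, none) :: rest => (a, none) :: incAtList n rest
  | n, (a, some t) :: rest => (a, some (incAt n t)) :: incAtList n rest
end

mutual
/-- Locator substitution `t[ρ^n ↦ u]`. -/
def subst : Tm L → Nat → Tm L → Tm L
  | loc m, n, u => if m < n then loc m else if m = n then u else loc (m - 1)
  | dot t a, n, u => dot (subst t n u) a
  | app t a v, n, u => app (subst t n u) a (subst v n u)
  | obj attrs, n, u => obj (substList attrs (n + 1) (incAt 0 u))

def substList : List (L × Option (Tm L)) → Nat → Tm L → List (L × Option (Tm L))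
  | [], _, _ => []
  | (a, none) :: rest, n, u => (a, none) :: substList rest n u
  | (a, some t) :: rest, n, u => (a, some (subst t n u)) :: substList rest n u
end

section Reductions

variable [DecidableEq L]

/-- One-step (regular) reduction `⇝`, parametrized by the decorator label `phi`. -/
inductive Step (phi : L) : Tm L → Tm L → Prop where
  | congObj {t t' : Tm L} (pre post : List (L × Option (Tm L))) (b : L) :
      Step phi t t' →
      Step phi (obj (pre ++ (b, some t) :: post)) (obj (pre ++ (b, some t') :: post))
  | congDot {t t' : Tm L} (a : L) : Step phi t t' → Step phi (dot t a) (dot t' a)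
  | congAppL {t t' u : Tm L} (a : L) : Step phi t t' → Step phi (app t a u) (app t' a u)
  | congAppR {t u u' : Tm L} (a : L) : Step phi u u' → Step phi (app t a u) (app t a u')
  | dotStep {attrs : List (L × Option (Tm L))} {c : L} {tc : Tm L} :
      lookupAttr c attrs = some (some tc) →
      Step phi (dot (obj attrs) c) (subst tc 0 (obj attrs))
  | dotPhi {attrs : List (L × Option (Tm L))} {c : L} :
      lookupAttr c attrs = none → (lookupAttr phi attrs).isSome →
      Step phi (dot (obj attrs) c) (dot (dot (obj attrs) phi) c)
  | appStep {attrs : List (L × Option (Tm L))} {c : L} {u : Tm L} :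
      lookupAttr c attrs = some none →
      Step phi (app (obj attrs) c u) (obj (attachAttr c (incAt 0 u) attrs))

mutual
/-- Parallel reduction `⇛`. -/
inductive Par (phi : L) : Tm L → Tm L → Prop where
  | loc (n : Nat) : Par phi (Tm.loc n) (Tm.loc n)
  | obj {attrs attrs' : List (L × Option (Tm L))} :
      ParAttrs phi attrs attrs' → Par phi (Tm.obj attrs) (Tm.obj attrs')
  | congDot {t t' : Tm L} (a : L) : Par phi t t' → Par phi (Tm.dot t a) (Tm.dot t' a)
  | congApp {t t' u u' : Tm L} (a : L) :
      Par phi t t' → Par phi u u' → Par phi (Tm.app t a u) (Tm.app t' a u')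
  | dotPar {t : Tm L} {attrs : List (L × Option (Tm L))} {c : L} {tc : Tm L} :
      Par phi t (Tm.obj attrs) → lookupAttr c attrs = some (some tc) →
      Par phi (Tm.dot t c) (subst tc 0 (Tm.obj attrs))
  | dotPhi {t : Tm L} {attrs : List (L × Option (Tm L))} {c : L} :
      Par phi t (Tm.obj attrs) → lookupAttr c attrs = none →
      (lookupAttr phi attrs).isSome →
      Par phi (Tm.dot t c) (Tm.dot (Tm.dot (Tm.obj attrs) phi) c)
  | appPar {t : Tm L} {attrs : List (L × Option (Tm L))} {c : L} {u u' : Tm L} :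
      Par phi t (Tm.obj attrs) → lookupAttr c attrs = some none → Par phi u u' →
      Par phi (Tm.app t c u) (Tm.obj (attachAttr c (incAt 0 u') attrs))

/-- Pointwise parallel reduction on attribute lists: void attributes are kept,
attached attributes reduce in parallel. -/
inductive ParAttrs (phi : L) :
    List (L × Option (Tm L)) → List (L × Option (Tm L)) → Prop where
  | nil : ParAttrs phi [] []
  | void {rest rest' : List (L × Option (Tm L))} (a : L) :
      ParAttrs phi rest rest' → ParAttrs phi ((a, none) :: rest) ((a, none) :: rest')
  | attached {t t' : Tm L} {rest rest' : List (L × Option (Tm L))} (a : L) :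
      Par phi t t' → ParAttrs phi rest rest' →
      ParAttrs phi ((a, some t) :: rest) ((a, some t') :: rest')
end

/-- Head reduction `→h`. -/
inductive Head (phi : L) : Tm L → Tm L → Prop where
  | dotStep {attrs : List (L × Option (Tm L))} {c : L} {tc : Tm L} :
      lookupAttr c attrs = some (some tc) →
      Head phi (dot (obj attrs) c) (subst tc 0 (obj attrs))
  | dotPhi {attrs : List (L × Option (Tm L))} {c : L} :
      lookupAttr c attrs = none → (lookupAttr phi attrs).isSome →
      Head phi (dot (obj attrs) c) (dot (dot (obj attrs) phi) c)
  | appStep {attrs : List (L × Option (Tm L))} {c : L} {u : Tm L} :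
      lookupAttr c attrs = some none →
      Head phi (app (obj attrs) c u) (obj (attachAttr c (incAt 0 u) attrs))
  | congDot {t t' : Tm L} (a : L) : Head phi t t' → Head phi (dot t a) (dot t' a)
  | congApp {t t' u : Tm L} (a : L) : Head phi t t' → Head phi (app t a u) (app t' a u)

/-- Internal parallel reduction `⇛ᵢ`. -/
inductive ParI (phi : L) : Tm L → Tm L → Prop where
  | loc (n : Nat) : ParI phi (Tm.loc n) (Tm.loc n)
  | obj {attrs attrs' : List (L × Option (Tm L))} :
      ParAttrs phi attrs attrs' → ParI phi (Tm.obj attrs) (Tm.obj attrs')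
  | congDot {t t' : Tm L} (a : L) : ParI phi t t' → ParI phi (Tm.dot t a) (Tm.dot t' a)
  | congApp {t t' u u' : Tm L} (a : L) :
      ParI phi t t' → Par phi u u' → ParI phi (Tm.app t a u) (Tm.app t' a u')

/-- Internal (regular) reduction `→ᵢ`. -/
inductive StepI (phi : L) : Tm L → Tm L → Prop where
  | congObj {t t' : Tm L} (pre post : List (L × Option (Tm L))) (b : L) :
      Step phi t t' →
      StepI phi (obj (pre ++ (b, some t) :: post)) (obj (pre ++ (b, some t') :: post))
  | congDot {t t' : Tm L} (a : L) : StepI phi t t' → StepI phi (dot t a) (dot t' a)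
  | congAppL {t t' u : Tm L} (a : L) : StepI phi t t' → StepI phi (app t a u) (app t' a u)
  | congAppR {t u u' : Tm L} (a : L) : Step phi u u' → StepI phi (app t a u) (app t a u')

end Reductions

end Tm

end PhiCalc
namespace PhiCalc
namespace Tm
section Extra
variable {L : Type} [DecidableEq L]

mutual
/-- Complete development `t⁺`. -/
def cd (phi : L) : Tm L → Tm L
  | loc n => loc n
  | dot t a =>
    match cd phi t with
    | obj attrs =>
      match lookupAttr a attrs with
      | some (some ta) => subst ta 0 (obj attrs)
      | some none => dot (obj attrs) a
      | none =>
        if (lookupAttr phi attrs).isSome then dot (dot (obj attrs) phi) a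
        else dot (obj attrs) a
    | t' => dot t' a
  | app t a u =>
    match cd phi t with
    | obj attrs =>
      match lookupAttr a attrs with
      | some none => obj (attachAttr a (incAt 0 (cd phi u)) attrs)
      | _ => app (obj attrs) a (cd phi u)
    | t' => app t' a (cd phi u)
  | obj attrs => obj (cdList phi attrs)

def cdList (phi : L) : List (L × Option (Tm L)) → List (L × Option (Tm L))
  | [] => []
  | (a, none) :: rest => (a, none) :: cdList phi rest
  | (a, some t) :: rest => (a, some (cd phi t)) :: cdList phi rest
end

/-- Head reduction as a (deterministic) partial function. -/
def headRed (phi : L) : Tm L → Option (Tm L)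
  | loc _ => none
  | obj _ => none
  | dot t a =>
    match t with
    | obj attrs =>
      match lookupAttr a attrs with
      | some (some ta) => some (subst ta 0 (obj attrs))
      | some none => none
      | none =>
        if (lookupAttr phi attrs).isSome then some (dot (dot (obj attrs) phi) a)
        else none
    | t => (headRed phi t).map (fun t' => dot t' a)
  | app t a u =>
    match t with
    | obj attrs =>
      match lookupAttr a attrs with
      | some none => some (obj (attachAttr a (incAt 0 u) attrs))
      | _ => none
    | t => (headRed phi t).map (fun t' => app t' a u)

mutual
/-- Normal order reduction `⇝ℓ` as a (deterministic) partial function: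
head reduction first, otherwise reduce the leftmost subterm that reduces. -/
def nordRed (phi : L) : Tm L → Option (Tm L)
  | loc _ => none
  | dot t a =>
    match headRed phi (dot t a) with
    | some s => some s
    | none => (nordRed phi t).map (fun t' => dot t' a)
  | app t a u =>
    match headRed phi (app t a u) with
    | some s => some s
    | none =>
      match nordRed phi t with
      | some t' => some (app t' a u)
      | none => (nordRed phi u).map (fun u' => app t a u')
  | obj attrs => (nordList phi attrs).map obj

def nordList (phi : L) : List (L × Option (Tm L)) → Option (List (L × Option (Tm L)))
  | [] => none
  | (a, none) :: rest => (nordList phi rest).map (fun rest' => (a, none) :: rest')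
  | (a, some t) :: rest =>
    match nordRed phi t with
    | some t' => some ((a, some t') :: rest)
    | none => (nordList phi rest).map (fun rest' => (a, some t) :: rest')
end

/-- Normal order reduction relation. -/
def NOrd (phi : L) (t t' : Tm L) : Prop := nordRed phi t = some t'

end Extra
end Tm
end PhiCalc
namespace PhiCalc
namespace Tm

mutual
theorem par_cd {L : Type} [DecidableEq L] (phi : L) : ∀ t : Tm L, Par phi t (cd phi t)
  | loc n => by
    rw [cd]
    exact .loc n
  | dot t a => by
    have ih := par_cd phi t
    rw [cd]
    split
    · rename_i attrs h
      rw [h] at ih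
      split
      · rename_i ta ha
        exact .dotPar ih ha
      · exact .congDot a ih
      · rename_i ha
        split
        · rename_i hphi
          exact .dotPhi ih ha hphi
        · exact .congDot a ih
    · exact .congDot a ih
  | app t a u => by
    have iht := par_cd phi t
    have ihu := par_cd phi u
    rw [cd]
    split
    · rename_i attrs h
      rw [h] at iht
      split
      · rename_i ha
        exact .appPar iht ha ihu
      · exact .congApp a iht ihu
    · exact .congApp a iht ihu
  | obj attrs => by
    rw [cd]
    exact .obj (parAttrs_cdList phi attrs)

theorem parAttrs_cdList {L : Type} [DecidableEq L] (phi : L) :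
    ∀ attrs : List (L × Option (Tm L)), ParAttrs phi attrs (cdList phi attrs)
  | [] => by
    rw [cdList]
    exact .nil
  | (a, none) :: rest => by
    rw [cdList]
    exact .void a (parAttrs_cdList phi rest)
  | (a, some t) :: rest => by
    rw [cdList]
    exact .attached a (par_cd phi t) (parAttrs_cdList phi rest)
end

end Tm
end PhiCalc

open PhiCalc Tm in
/-- Every φ-term parallel-reduces to its complete development: `t ⇛ t⁺`. -/
theorem par_to_complete_development {L : Type} [DecidableEq L] (phi : L) (t : Tm L) :
    Par phi t (cd phi t) := by
  exact par_cd phi t
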